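/- With the Q-polynomial distance-regular graph setup, let W be an irreducible T-module with endpoint ρ, dual endpoint τ, and diameter d. Then for each μ, ν ∈ {↓,↑}, W = W^{μν}_0 + W^{μν}_1 + ⋯ + W^{μν}_d is a direct sum, where for 0 ≤ h ≤ d: W^{↓↓}_h = (E*_ρW+⋯+E*_{ρ+h}W) ∩ (E_τW+⋯+E_{τ+d−h}W), W^{↑↓}_h = (E*_{ρ+d−h}W+⋯+E*_{ρ+d}W) ∩ (E_τW+⋯+E_{τ+d−h}W), W^{↓↑}_h = (E*_ρW+⋯+E*_{ρ+h}W) ∩ (E_{τ+h}W+⋯+E_{τ+d}W), W^{↑↑}_h = (E*_{ρ+d−h}W+⋯+E*_{ρ+d}W) ∩ (E_{τ+h}W+⋯+E_{τ+d}W). -/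

import Mathlib

noncomputable section

open Matrix Finset
open scoped ComplexInnerProductSpace

/-- A `Q`-polynomial distance-regular graph setup: a finite connected simple graph `G` on `X`
with diameter `D ≥ 3`, intersection numbers `p h i j`, primitive idempotents
`E 0, …, E D` of the Bose–Mesner algebra with (distinct, real) eigenvalues `θ 0, …, θ D`,
and Krein parameters `q h i j` satisfying the `Q`-polynomial condition with respect to the
ordering `E 0, …, E D`. -/
structure QPolyDRG (X : Type*) [Fintype X] [DecidableEq X] where
  G : SimpleGraph X
  conn : G.Connected
  D : ℕ
  hD3 : 3 ≤ D
  dist_le : ∀ y z : X, G.dist y z ≤ D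
  dist_eq : ∃ y z : X, G.dist y z = D
  p : ℕ → ℕ → ℕ → ℕ
  hp : ∀ h i j : ℕ, h ≤ D → i ≤ D → j ≤ D → ∀ y z : X, G.dist y z = h →
    Nat.card {w : X // G.dist y w = i ∧ G.dist w z = j} = p h i j
  E : ℕ → Matrix X X ℂ
  θ : ℕ → ℝ
  q : ℕ → ℕ → ℕ → ℝ
  hE0 : E 0 = ((Fintype.card X : ℂ))⁻¹ • Matrix.of (fun _ _ => (1 : ℂ))
  hEsum : ∑ i ∈ Finset.range (D + 1), E i = 1
  hEmul : ∀ i ≤ D, ∀ j ≤ D, E i * E j = if i = j then E i else 0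
  hEsym : ∀ i ≤ D, (E i)ᵀ = E i
  hEreal : ∀ i ≤ D, ∀ y z : X, ((E i) y z).im = 0
  hEinM : ∀ i ≤ D, E i ∈ Submodule.span ℂ
    {B : Matrix X X ℂ | ∃ k ≤ D, B = Matrix.of (fun y z => if G.dist y z = k then (1 : ℂ) else 0)}
  hAE : ∀ i ≤ D,
    Matrix.of (fun y z => if G.dist y z = 1 then (1 : ℂ) else 0) * E i = (θ i : ℂ) • E i
  θ_inj : ∀ i ≤ D, ∀ j ≤ D, θ i = θ j → i = j
  hKrein : ∀ i ≤ D, ∀ j ≤ D, Matrix.hadamard (E i) (E j) =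
    ((Fintype.card X : ℂ))⁻¹ • ∑ h ∈ Finset.range (D + 1), (q h i j : ℂ) • E h
  hq_zero : ∀ h ≤ D, ∀ i ≤ D, ∀ j ≤ D, (i + j < h ∨ h + j < i ∨ h + i < j) → q h i j = 0
  hq_ne : ∀ h ≤ D, ∀ i ≤ D, ∀ j ≤ D, (h = i + j ∨ i = h + j ∨ j = h + i) → q h i j ≠ 0

namespace QPolyDRG

variable {X : Type*} [Fintype X] [DecidableEq X] (S : QPolyDRG X) (x : X)

/-- The `i`-th distance matrix `A_i`. -/
def Amat (i : ℕ) : Matrix X X ℂ :=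
  Matrix.of (fun y z => if S.G.dist y z = i then (1 : ℂ) else 0)

/-- The adjacency matrix `A = A_1`. -/
def adj : Matrix X X ℂ := S.Amat 1

/-- The `i`-th dual idempotent `E*_i = E*_i(x)` with respect to the base vertex `x`. -/
def Estar (i : ℕ) : Matrix X X ℂ :=
  Matrix.diagonal (fun y => if S.G.dist x y = i then (1 : ℂ) else 0)

/-- The dual adjacency matrix `A* = A*(x)`, with `(A*)_{yy} = |X| (E_1)_{xy}`. -/
def Astar : Matrix X X ℂ :=
  Matrix.diagonal (fun y => (Fintype.card X : ℂ) * S.E 1 x y)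

/-- The subspace `E_i V` of the standard module, with the convention that it is `0`
for `i ∉ {0, …, D}`. -/
def EV (i : ℤ) : Submodule ℂ (EuclideanSpace ℂ X) :=
  if 0 ≤ i ∧ i ≤ S.D then LinearMap.range (Matrix.toEuclideanLin (S.E i.toNat)) else ⊥

/-- The `i`-th subconstituent `E*_i V` with respect to `x`, with the convention that it is `0`
for `i ∉ {0, …, D}`. -/
def EstarV (i : ℤ) : Submodule ℂ (EuclideanSpace ℂ X) :=
  if 0 ≤ i ∧ i ≤ S.D then LinearMap.range (Matrix.toEuclideanLin (S.Estar x i.toNat)) else ⊥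

/-- The subconstituent (Terwilliger) algebra `T = T(x)`, generated by `A` and `A*`. -/
def Talg : Subalgebra ℂ (Matrix X X ℂ) := Algebra.adjoin ℂ {S.adj, S.Astar x}

/-- A `T`-module: a subspace `W ⊆ V` with `B W ⊆ W` for all `B ∈ T`. -/
def IsTModule (W : Submodule ℂ (EuclideanSpace ℂ X)) : Prop :=
  ∀ B ∈ S.Talg x, ∀ w ∈ W, Matrix.toEuclideanLin B w ∈ W

/-- An irreducible `T`-module. -/
def IsIrredTModule (W : Submodule ℂ (EuclideanSpace ℂ X)) : Prop :=
  S.IsTModule x W ∧ W ≠ ⊥ ∧ ∀ W' ≤ W, S.IsTModule x W' → W' = ⊥ ∨ W' = W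

/-- The subspace `E_i W`, with the convention that it is `0` for `i ∉ {0, …, D}`. -/
def EW (W : Submodule ℂ (EuclideanSpace ℂ X)) (i : ℤ) : Submodule ℂ (EuclideanSpace ℂ X) :=
  if 0 ≤ i ∧ i ≤ S.D then Submodule.map (Matrix.toEuclideanLin (S.E i.toNat)) W else ⊥

/-- The subspace `E*_i W`, with the convention that it is `0` for `i ∉ {0, …, D}`. -/
def EstarW (W : Submodule ℂ (EuclideanSpace ℂ X)) (i : ℤ) : Submodule ℂ (EuclideanSpace ℂ X) :=
  if 0 ≤ i ∧ i ≤ S.D then Submodule.map (Matrix.toEuclideanLin (S.Estar x i.toNat)) W else ⊥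


/-- The endpoint `ρ = min { i : E*_i W ≠ 0 }` of a `T`-module `W`. -/
def endpt (W : Submodule ℂ (EuclideanSpace ℂ X)) : ℕ :=
  sInf {i : ℕ | i ≤ S.D ∧ S.EstarW x W i ≠ ⊥}

/-- The dual endpoint `τ = min { i : E_i W ≠ 0 }` of a `T`-module `W`. -/
def dualEndpt (W : Submodule ℂ (EuclideanSpace ℂ X)) : ℕ :=
  sInf {i : ℕ | i ≤ S.D ∧ S.EW W i ≠ ⊥}

/-- The diameter `d = |{ i : E*_i W ≠ 0 }| - 1` of a `T`-module `W`. -/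
def diam (W : Submodule ℂ (EuclideanSpace ℂ X)) : ℕ :=
  Set.ncard {i : ℕ | i ≤ S.D ∧ S.EstarW x W i ≠ ⊥} - 1

/-- The dual diameter `|{ i : E_i W ≠ 0 }| - 1` of a `T`-module `W`. -/
def dualDiam (W : Submodule ℂ (EuclideanSpace ℂ X)) : ℕ :=
  Set.ncard {i : ℕ | i ≤ S.D ∧ S.EW W i ≠ ⊥} - 1

/-- The split subspace `W^{μν}_h` of an irreducible `T`-module `W` with endpoint `ρ`,
dual endpoint `τ` and diameter `d`.  Here `μ = false` stands for `↓` and `μ = true`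
for `↑`, and similarly for `ν`; e.g.
`W^{↓↓}_h = (E*_ρ W + ⋯ + E*_{ρ+h} W) ∩ (E_τ W + ⋯ + E_{τ+d-h} W)`. -/
def Wsplit (W : Submodule ℂ (EuclideanSpace ℂ X)) (ρ τ d : ℕ) (μ ν : Bool) (h : ℕ) :
    Submodule ℂ (EuclideanSpace ℂ X) :=
  (if μ then ⨆ k ∈ Finset.Icc (ρ + d - h) (ρ + d), S.EstarW x W k
    else ⨆ k ∈ Finset.Icc ρ (ρ + h), S.EstarW x W k) ⊓
  (if ν then ⨆ k ∈ Finset.Icc (τ + h) (τ + d), S.EW W k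
    else ⨆ k ∈ Finset.Icc τ (τ + d - h), S.EW W k)

/-- The subspace `V^{μν}_{i,j}` (interpreted as `0` if `i = -1` or `j = -1`).
Here `μ = false` stands for `↓` and `μ = true` for `↑`, and similarly for `ν`; e.g.
`V^{↓↓}_{i,j} = (E*_0 V + ⋯ + E*_i V) ∩ (E_0 V + ⋯ + E_j V)` and
`V^{↑↑}_{i,j} = (E*_D V + ⋯ + E*_{D-i} V) ∩ (E_D V + ⋯ + E_{D-j} V)`. -/
def Vsplit (μ ν : Bool) (i j : ℤ) : Submodule ℂ (EuclideanSpace ℂ X) :=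
  if 0 ≤ i ∧ 0 ≤ j then
    (if μ then ⨆ k ∈ Finset.Icc (S.D - i.toNat) S.D, S.EstarV x k
      else ⨆ k ∈ Finset.range (i.toNat + 1), S.EstarV x k) ⊓
    (if ν then ⨆ k ∈ Finset.Icc (S.D - j.toNat) S.D, S.EV k
      else ⨆ k ∈ Finset.range (j.toNat + 1), S.EV k)
  else ⊥

/-- The subspace `Ṽ^{μν}_{i,j}`: the orthogonal complement of
`V^{μν}_{i-1,j} + V^{μν}_{i,j-1}` in `V^{μν}_{i,j}` with respect to the standard
Hermitian form. -/
def tildeV (μ ν : Bool) (i j : ℕ) : Submodule ℂ (EuclideanSpace ℂ X) :=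
  S.Vsplit x μ ν i j ⊓ (S.Vsplit x μ ν ((i : ℤ) - 1) j ⊔ S.Vsplit x μ ν i ((j : ℤ) - 1))ᗮ

end QPolyDRG

section helpers

theorem iSupIndep_of_lt {V : Type*} [AddCommGroup V] [Module ℂ V] {n : ℕ}
    (U : Fin n → Submodule ℂ V)
    (h : ∀ i, U i ⊓ (⨆ j, ⨆ (_ : j < i), U j) = ⊥) : iSupIndep U := by
  classical
  rw [iSupIndep_iff_finsetSum_eq_zero_imp_eq_zero]
  intro s
  induction s using Finset.induction_on_max with
  | empty => simp
  | insert a s hlt ih =>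
    intro v hv hsum
    have ha : a ∉ s := fun h => lt_irrefl _ (hlt a h)
    rw [Finset.sum_insert ha] at hsum
    have hs : ∑ i ∈ s, v i ∈ (⨆ j, ⨆ (_ : j < a), U j) := by
      refine Submodule.sum_mem _ fun i hi => ?_
      exact (le_iSup₂_of_le (f := fun j (_ : j < a) => U j) i (hlt i hi) le_rfl)
        (hv i (Finset.mem_insert_of_mem hi))
    have hva : v a = 0 := by
      have : v a ∈ U a ⊓ (⨆ j, ⨆ (_ : j < a), U j) := by
        refine ⟨hv a (Finset.mem_insert_self _ _), ?_⟩
        rw [eq_neg_of_add_eq_zero_left hsum]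
        exact Submodule.neg_mem _ hs
      rw [h] at this
      simpa using this
    intro i hi
    rcases Finset.mem_insert.1 hi with rfl | hi
    · exact hva
    · refine ih v (fun j hj => hv j (Finset.mem_insert_of_mem hj)) ?_ i hi
      simpa [hva] using hsum

/-- One half of a tridiagonal system. -/
structure HalfTD {V : Type*} [AddCommGroup V] [Module ℂ V] (W : Submodule ℂ V)
    (A B : V →ₗ[ℂ] V) (P : ℤ → Submodule ℂ V) (b : ℤ → ℂ) : Prop where
  sup : ⨆ i, P i = W
  ne : ∀ i, P i ≠ ⊥ → ∀ N : Submodule ℂ V, (∀ k, k ≠ i → P k ≤ N) →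
    (∀ N' : Submodule ℂ V, (∀ k, k ≠ i → P k ≤ N') → N ≤ N') → N ≠ W
  eig : ∀ i, ∀ v ∈ P i, B v = b i • v
  tri : ∀ i, ∀ v ∈ P i, A v ∈ P (i - 1) ⊔ P i ⊔ P (i + 1)

variable {V : Type*} [AddCommGroup V] [Module ℂ V] {W : Submodule ℂ V}
    {A B : V →ₗ[ℂ] V} {P Q : ℤ → Submodule ℂ V} {a b : ℤ → ℂ}

theorem HalfTD.ne' (h : HalfTD W A B P b) {i : ℤ} (hi : P i ≠ ⊥) {N : Submodule ℂ V}
    (hN : N ≤ ⨆ k, ⨆ (_ : k ≠ i), P k) : N ≠ W := by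
  intro hNW
  refine h.ne i hi (⨆ k, ⨆ (_ : k ≠ i), P k) (fun k hk => le_iSup₂_of_le k hk le_rfl)
    (fun N' h' => iSup₂_le h') (le_antisymm ?_ (hNW ▸ hN))
  rw [← h.sup]
  exact iSup₂_le fun k _ => le_iSup P k

theorem HalfTD.shift (h : HalfTD W A B P b) (c : ℤ) :
    HalfTD W A B (fun i => P (c + i)) (fun i => b (c + i)) where
  sup := by
    rw [← h.sup]
    exact (Equiv.addLeft c).iSup_comp (g := P)
  ne := by
    intro i hi N h1 h2
    refine h.ne (c + i) hi N (fun k hk => ?_) (fun N' h' => h2 N' fun k hk => h' _ (by omega))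
    have := h1 (k - c) (by omega)
    simpa using this
  eig := fun i v hv => h.eig _ v hv
  tri := by
    intro i v hv
    have := h.tri _ v hv
    rwa [show c + i - 1 = c + (i - 1) by ring, show c + i + 1 = c + (i + 1) by ring] at this

theorem HalfTD.refl (h : HalfTD W A B P b) (c : ℤ) :
    HalfTD W A B (fun i => P (c - i)) (fun i => b (c - i)) where
  sup := by
    rw [← h.sup]
    exact (Equiv.subLeft c).iSup_comp (g := P)
  ne := by
    intro i hi N h1 h2
    refine h.ne (c - i) hi N (fun k hk => ?_) (fun N' h' => h2 N' fun k hk => h' _ (by omega))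
    have := h1 (c - k) (by omega)
    simpa using this
  eig := fun i v hv => h.eig _ v hv
  tri := by
    intro i v hv
    have := h.tri _ v hv
    rw [show c - i - 1 = c - (i + 1) by ring, show c - i + 1 = c - (i - 1) by ring] at this
    rwa [sup_comm, ← sup_assoc, sup_right_comm] at this

/-- A-step, F flag. -/
theorem HalfTD.F_A (h : HalfTD W A B P b) (i : ℤ) :
    ∀ v ∈ (⨆ k, ⨆ (_ : k ≤ i), P k), A v ∈ (⨆ k, ⨆ (_ : k ≤ i + 1), P k) := by
  suffices (⨆ k, ⨆ (_ : k ≤ i), P k) ≤ (⨆ k, ⨆ (_ : k ≤ i + 1), P k).comap A from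
    fun v hv => this hv
  refine iSup₂_le fun k hk v hv => ?_
  refine (sup_le (sup_le ?_ ?_) ?_ : P (k-1) ⊔ P k ⊔ P (k+1) ≤ ⨆ k, ⨆ (_ : k ≤ i + 1), P k) (h.tri k v hv)
  · exact le_iSup₂_of_le (f := fun k (_ : k ≤ i + 1) => P k) (k-1) (by omega) le_rfl
  · exact le_iSup₂_of_le (f := fun k (_ : k ≤ i + 1) => P k) k (by omega) le_rfl
  · exact le_iSup₂_of_le (f := fun k (_ : k ≤ i + 1) => P k) (k+1) (by omega) le_rfl

theorem HalfTD.F_B (h : HalfTD W A B P b) (i : ℤ) :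
    ∀ v ∈ (⨆ k, ⨆ (_ : k ≤ i), P k), B v - b i • v ∈ (⨆ k, ⨆ (_ : k ≤ i - 1), P k) := by
  suffices (⨆ k, ⨆ (_ : k ≤ i), P k) ≤
      (⨆ k, ⨆ (_ : k ≤ i - 1), P k).comap (B - b i • LinearMap.id) from
    fun v hv => by simpa using this hv
  refine iSup₂_le fun k hk v hv => ?_
  simp only [Submodule.mem_comap, LinearMap.sub_apply, LinearMap.smul_apply, LinearMap.id_apply,
    h.eig k v hv, ← sub_smul]
  rcases eq_or_lt_of_le hk with rfl | hk
  · simp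
  · exact Submodule.smul_mem _ _
      ((le_iSup₂_of_le (f := fun k (_ : k ≤ i - 1) => P k) k (by omega) le_rfl) hv)

theorem ge_eq_refl (P : ℤ → Submodule ℂ V) (i : ℤ) :
    (⨆ k, ⨆ (_ : i ≤ k), P k) = ⨆ k, ⨆ (_ : k ≤ -i), P (0 - k) := by
  refine le_antisymm (iSup₂_le fun k hk => ?_) (iSup₂_le fun k hk => ?_)
  · refine le_iSup₂_of_le (f := fun k (_ : k ≤ -i) => P (0 - k)) (-k) (by omega) ?_
    simp
  · exact le_iSup₂_of_le (f := fun k (_ : i ≤ k) => P k) (0-k) (by omega) le_rfl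

theorem HalfTD.G_A (h : HalfTD W A B P b) (i : ℤ) :
    ∀ v ∈ (⨆ k, ⨆ (_ : i ≤ k), P k), A v ∈ (⨆ k, ⨆ (_ : i - 1 ≤ k), P k) := by
  intro v hv
  rw [ge_eq_refl] at hv ⊢
  have := (h.refl 0).F_A (-i) v hv
  rwa [show -(i-1) = -i + 1 by ring]

theorem HalfTD.G_B (h : HalfTD W A B P b) (i : ℤ) :
    ∀ v ∈ (⨆ k, ⨆ (_ : i ≤ k), P k), B v - b i • v ∈ (⨆ k, ⨆ (_ : i + 1 ≤ k), P k) := by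
  intro v hv
  rw [ge_eq_refl] at hv ⊢
  have := (h.refl 0).F_B (-i) v hv
  rw [show -(i+1) = -i - 1 by ring]
  simpa using this

theorem HalfTD.convex (h : HalfTD W A B P b)
    (irr : ∀ N ≤ W, (∀ v ∈ N, A v ∈ N) → (∀ v ∈ N, B v ∈ N) → N = ⊥ ∨ N = W)
    {i j k : ℤ} (hij : i < j) (hjk : j < k) (hi : P i ≠ ⊥) (hk : P k ≠ ⊥) : P j ≠ ⊥ := by
  intro hj
  have heq : (⨆ l, ⨆ (_ : l ≤ j), P l) = (⨆ l, ⨆ (_ : l ≤ j - 1), P l) := by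
    refine le_antisymm (iSup₂_le fun l hl => ?_) (iSup₂_le fun l hl => ?_)
    · rcases eq_or_lt_of_le hl with rfl | hl
      · simp [hj]
      · exact le_iSup₂_of_le (f := fun k (_ : k ≤ j - 1) => P k) l (by omega) le_rfl
    · exact le_iSup₂_of_le (f := fun k (_ : k ≤ j) => P k) l (by omega) le_rfl
  have h1 : (⨆ l, ⨆ (_ : l ≤ j - 1), P l) ≤ W := by
    rw [← h.sup]
    exact iSup₂_le fun k _ => le_iSup P k
  have h2 : ∀ v ∈ (⨆ l, ⨆ (_ : l ≤ j - 1), P l), A v ∈ (⨆ l, ⨆ (_ : l ≤ j - 1), P l) := by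
    intro v hv
    have := h.F_A _ v hv
    rwa [sub_add_cancel, heq] at this
  have h3 : ∀ v ∈ (⨆ l, ⨆ (_ : l ≤ j - 1), P l), B v ∈ (⨆ l, ⨆ (_ : l ≤ j - 1), P l) := by
    intro v hv
    have := h.F_B j v (by rw [heq]; exact hv)
    simpa using Submodule.add_mem _ this (Submodule.smul_mem _ (b j) hv)
  rcases irr _ h1 h2 h3 with h0 | h0
  · apply hi
    rw [eq_bot_iff, ← h0]
    exact le_iSup₂_of_le (f := fun k (_ : k ≤ j - 1) => P k) i (by omega) le_rfl
  · refine h.ne' hk ?_ h0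
    exact iSup₂_le fun l hl => le_iSup₂_of_le (f := fun l (_ : l ≠ k) => P l) l (by omega) le_rfl

theorem td_main (hP : HalfTD W A B P b) (hQ : HalfTD W B A Q a)
    (irr : ∀ N ≤ W, (∀ v ∈ N, A v ∈ N) → (∀ v ∈ N, B v ∈ N) → N = ⊥ ∨ N = W)
    (d δ : ℕ) (hPd : ∀ i, P i ≠ ⊥ ↔ 0 ≤ i ∧ i ≤ d) (hQd : ∀ i, Q i ≠ ⊥ ↔ 0 ≤ i ∧ i ≤ δ) :
    d = δ ∧ iSupIndep (fun h : Fin (d + 1) =>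
      (⨆ k, ⨆ (_ : k ≤ (h : ℤ)), P k) ⊓ (⨆ k, ⨆ (_ : (h : ℤ) ≤ k), Q k)) ∧
      (⨆ h : Fin (d + 1),
      (⨆ k, ⨆ (_ : k ≤ ((h : ℕ) : ℤ)), P k) ⊓ (⨆ k, ⨆ (_ : ((h : ℕ) : ℤ) ≤ k), Q k)) = W := by
  obtain ⟨F, hF⟩ : ∃ F : ℤ → Submodule ℂ V, ∀ i, F i = ⨆ k, ⨆ (_ : k ≤ i), P k :=
    ⟨_, fun _ => rfl⟩
  obtain ⟨G, hG⟩ : ∃ G : ℤ → Submodule ℂ V, ∀ i, G i = ⨆ k, ⨆ (_ : i ≤ k), Q k :=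
    ⟨_, fun _ => rfl⟩
  have FA := hP.F_A
  have FB := hP.F_B
  have GB := hQ.G_A
  have GA := hQ.G_B
  simp only [← hF] at FA FB
  simp only [← hG] at GA GB
  simp only [← hF, ← hG]
  have PF : ∀ k i, k ≤ i → P k ≤ F i := fun k i hk => by
    rw [hF]; exact le_iSup₂_of_le (f := fun k (_ : k ≤ i) => P k) k hk le_rfl
  have QG : ∀ k i, i ≤ k → Q k ≤ G i := fun k i hk => by
    rw [hG]; exact le_iSup₂_of_le (f := fun k (_ : i ≤ k) => Q k) k hk le_rfl
  have Fmono : Monotone F := fun i j hij => by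
    rw [hF i]; exact iSup₂_le fun k hk => PF k j (hk.trans hij)
  have Ganti : Antitone G := fun i j hij => by
    rw [hG j]; exact iSup₂_le fun k hk => QG k i (hij.trans hk)
  have FW : ∀ i, F i ≤ W := fun i => by
    rw [hF, ← hP.sup]; exact iSup₂_le fun k _ => le_iSup P k
  have Fneg : ∀ i, i < 0 → F i = ⊥ := fun i hi => by
    rw [hF, eq_bot_iff]
    refine iSup₂_le fun k hk => ?_
    by_contra hne
    have := (hPd k).1 (fun h => hne (by rw [h]))
    omega
  have Gbig : ∀ i : ℤ, δ < i → G i = ⊥ := fun i hi => by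
    rw [hG, eq_bot_iff]
    refine iSup₂_le fun k hk => ?_
    by_contra hne
    have := (hQd k).1 (fun h => hne (by rw [h]))
    omega
  have Fd : W ≤ F d := by
    rw [← hP.sup]
    refine iSup_le fun k => ?_
    by_cases hk : P k = ⊥
    · rw [hk]; exact bot_le
    · exact PF _ _ ((hPd k).1 hk).2
  have G0 : W ≤ G 0 := by
    rw [← hQ.sup]
    refine iSup_le fun k => ?_
    by_cases hk : Q k = ⊥
    · rw [hk]; exact bot_le
    · exact QG _ _ ((hQd k).1 hk).1
  -- the invariant subspaces
  have hN : ∀ r : ℤ, (⨆ i, F i ⊓ G (i + r)) = ⊥ ∨ (⨆ i, F i ⊓ G (i + r)) = W := by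
    intro r
    refine irr _ (iSup_le fun i => inf_le_left.trans (FW i)) ?_ ?_
    · suffices (⨆ i, F i ⊓ G (i + r)) ≤ (⨆ i, F i ⊓ G (i + r)).comap A from fun v hv => this hv
      refine iSup_le fun i v hv => ?_
      have h1 : A v - a (i + r) • v ∈ F (i + 1) ⊓ G (i + 1 + r) := by
        refine ⟨Submodule.sub_mem _ (FA i v hv.1)
          (Submodule.smul_mem _ _ (Fmono (by omega) hv.1)), ?_⟩
        have := GA _ v hv.2
        rwa [show i + 1 + r = i + r + 1 by ring]
      have h2 := Submodule.add_mem _ (le_iSup (fun i => F i ⊓ G (i + r)) (i + 1) h1)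
        (Submodule.smul_mem _ (a (i + r)) (le_iSup (fun i => F i ⊓ G (i + r)) i hv))
      simpa using h2
    · suffices (⨆ i, F i ⊓ G (i + r)) ≤ (⨆ i, F i ⊓ G (i + r)).comap B from fun v hv => this hv
      refine iSup_le fun i v hv => ?_
      have h1 : B v - b i • v ∈ F (i - 1) ⊓ G (i - 1 + r) := by
        refine ⟨FB i v hv.1, ?_⟩
        have := GB _ v hv.2
        rw [show i - 1 + r = i + r - 1 by ring]
        exact Submodule.sub_mem _ this (Submodule.smul_mem _ _ (Ganti (by omega) hv.2))
      have h2 := Submodule.add_mem _ (le_iSup (fun i => F i ⊓ G (i + r)) (i - 1) h1)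
        (Submodule.smul_mem _ (b i) (le_iSup (fun i => F i ⊓ G (i + r)) i hv))
      simpa using h2
  have hN1 : (⨆ i, F i ⊓ G (i + 1)) = ⊥ := by
    refine (hN 1).resolve_right ?_
    refine hQ.ne' (i := 0) ((hQd 0).2 (by omega)) ?_
    have : G 1 ≤ ⨆ k, ⨆ (_ : k ≠ 0), Q k := by
      rw [hG]
      exact iSup₂_le fun l hl => le_iSup₂_of_le (f := fun l (_ : l ≠ 0) => Q l) l (by omega) le_rfl
    refine le_trans (iSup_le fun i => ?_) this
    by_cases hi : i < 0
    · rw [Fneg i hi]; simp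
    · exact inf_le_right.trans (Ganti (by omega))
  have hdis : ∀ i, F i ⊓ G (i + 1) = ⊥ := fun i => by
    rw [eq_bot_iff, ← hN1]; exact le_iSup (fun i => F i ⊓ G (i + 1)) i
  have hN0 : (⨆ i, F i ⊓ G i) = W := by
    have := hN 0
    simp only [add_zero] at this
    refine this.resolve_left fun h0 => ?_
    apply (hPd 0).2 (by omega)
    rw [eq_bot_iff, ← h0]
    refine le_trans (le_inf (PF 0 0 le_rfl) ?_) (le_iSup (fun i => F i ⊓ G i) 0)
    exact (PF 0 0 le_rfl).trans ((FW 0).trans G0)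
  have hdle : d ≤ δ := by
    by_contra hlt
    refine hP.ne' (i := d) ((hPd d).2 (by omega)) ?_ hN0
    have : F (d - 1) ≤ ⨆ k, ⨆ (_ : k ≠ (d : ℤ)), P k := by
      rw [hF]
      exact iSup₂_le fun l hl =>
        le_iSup₂_of_le (f := fun l (_ : l ≠ (d : ℤ)) => P l) l (by omega) le_rfl
    refine le_trans (iSup_le fun i => ?_) this
    by_cases hi : δ < i
    · rw [Gbig i hi]; simp
    · exact inf_le_left.trans (Fmono (by omega))
  have hled : δ ≤ d := by
    by_contra hlt
    apply (hQd δ).2 (by omega)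
    rw [eq_bot_iff, ← hdis d]
    refine le_inf (le_trans ?_ Fd) (QG _ _ (by omega))
    rw [← hQ.sup]; exact le_iSup Q _
  refine ⟨le_antisymm hdle hled, ?_, ?_⟩
  · apply iSupIndep_of_lt
    intro i
    rw [eq_bot_iff, ← hdis ((i : ℤ) - 1)]
    refine le_inf (inf_le_right.trans (iSup₂_le fun j hj => inf_le_left.trans (Fmono ?_))) ?_
    · have : (j : ℕ) < (i : ℕ) := hj
      omega
    · rw [sub_add_cancel]
      exact inf_le_left.trans inf_le_right
  · refine le_antisymm (iSup_le fun i => inf_le_left.trans (FW _)) ?_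
    conv_lhs => rw [← hN0]
    refine iSup_le fun i => ?_
    by_cases hi : i < 0
    · rw [Fneg i hi]; simp
    by_cases hi' : δ < i
    · rw [Gbig i hi']; simp
    refine le_trans (le_of_eq ?_) (le_iSup (fun h : Fin (d + 1) => F ((h : ℕ) : ℤ) ⊓ G ((h : ℕ) : ℤ))
      ⟨i.toNat, by omega⟩)
    simp only
    rw [Int.toNat_of_nonneg (by omega)]

end helpers
section helpers2

variable {X : Type*} [Fintype X] [DecidableEq X]

theorem tel_mul (M N : Matrix X X ℂ) (v : EuclideanSpace ℂ X) :
    Matrix.toEuclideanLin (M * N) v = Matrix.toEuclideanLin M (Matrix.toEuclideanLin N v) := by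
  rw [Matrix.toLpLin_mul_same]; rfl

theorem tel_one (v : EuclideanSpace ℂ X) :
    Matrix.toEuclideanLin (1 : Matrix X X ℂ) v = v := by
  rw [Matrix.toLpLin_one]; rfl

theorem idem_mem_adjoin (D : ℕ) (e : ℕ → Matrix X X ℂ) (M : Matrix X X ℂ) (t : ℕ → ℂ)
    (hsum : ∑ i ∈ Finset.range (D + 1), e i = 1) (hM : ∀ i ≤ D, M * e i = t i • e i)
    (ht : ∀ i ≤ D, ∀ j ≤ D, t i = t j → i = j) (i : ℕ) (hi : i ≤ D) :
    e i ∈ Algebra.adjoin ℂ {M} := by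
  have key : ∀ (p : Polynomial ℂ) (j : ℕ), j ≤ D →
      Polynomial.aeval M p * e j = p.eval (t j) • e j := by
    intro p j hj
    induction p using Polynomial.induction_on' with
    | add p q hp hq => simp [add_mul, add_smul, hp, hq]
    | monomial n c =>
      have : ∀ n : ℕ, M ^ n * e j = (t j) ^ n • e j := by
        intro n
        induction n with
        | zero => simp
        | succ n ih => rw [pow_succ, mul_assoc, hM j hj, mul_smul_comm, ih, smul_smul, pow_succ']
      rw [Polynomial.aeval_monomial, mul_assoc, this, Polynomial.eval_monomial,
        Algebra.algebraMap_eq_smul_one, smul_mul_assoc, one_mul, smul_smul]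
  have hinj : Set.InjOn t (Finset.range (D + 1) : Finset ℕ) := by
    intro a ha b hb hab
    simp only [Finset.coe_range, Set.mem_Iio] at ha hb
    exact ht a (by omega) b (by omega) hab
  have hmem : i ∈ Finset.range (D + 1) := by simp; omega
  have : e i = Polynomial.aeval M (Lagrange.basis (Finset.range (D + 1)) t i) := by
    rw [← mul_one (Polynomial.aeval M _), ← hsum, Finset.mul_sum,
      Finset.sum_eq_single_of_mem i hmem]
    · rw [key _ _ hi, Lagrange.eval_basis_self hinj hmem, one_smul]
    · intro j hj hji
      rw [key _ _ (by simp at hj; omega), Lagrange.eval_basis_of_ne hji.symm hj, zero_smul]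
  rw [this]
  exact Polynomial.aeval_mem_adjoin_singleton ℂ M

theorem halfTD_of (D : ℕ) (e : ℕ → Matrix X X ℂ) (M N : Matrix X X ℂ) (t : ℕ → ℂ)
    (W : Submodule ℂ (EuclideanSpace ℂ X))
    (hsum : ∑ i ∈ Finset.range (D + 1), e i = 1) (hM : ∀ i ≤ D, M * e i = t i • e i)
    (hmul : ∀ i ≤ D, ∀ j ≤ D, i ≠ j → e i * e j = 0)
    (heW : ∀ i ≤ D, ∀ w ∈ W, Matrix.toEuclideanLin (e i) w ∈ W)
    (hNW : ∀ w ∈ W, Matrix.toEuclideanLin N w ∈ W)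
    (htri : ∀ i ≤ D, ∀ j ≤ D, (i + 1 < j ∨ j + 1 < i) → e i * N * e j = 0) :
    HalfTD W (Matrix.toEuclideanLin N) (Matrix.toEuclideanLin M)
      (fun i : ℤ => if 0 ≤ i ∧ i ≤ D then
        Submodule.map (Matrix.toEuclideanLin (e i.toNat)) W else ⊥) (fun i => t i.toNat) := by
  have hdec : ∀ v : EuclideanSpace ℂ X,
      v = ∑ i ∈ Finset.range (D + 1), Matrix.toEuclideanLin (e i) v := by
    intro v
    conv_lhs => rw [← tel_one v, ← hsum, map_sum, LinearMap.sum_apply]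
  have hidem : ∀ i ≤ D, e i * e i = e i := by
    intro i hi
    conv_rhs => rw [← mul_one (e i), ← hsum, Finset.mul_sum]
    rw [Finset.sum_eq_single_of_mem i (by simp; omega)]
    intro j hj hji
    exact hmul i hi j (by simp at hj; omega) hji.symm
  refine ⟨?_, ?_, ?_, ?_⟩
  · refine le_antisymm (iSup_le fun i => ?_) fun w hw => ?_
    · split_ifs with h
      · rintro _ ⟨w, hw, rfl⟩
        exact heW _ (by omega) w hw
      · exact bot_le
    · rw [hdec w]
      refine Submodule.sum_mem _ fun i hi => ?_
      refine Submodule.mem_iSup_of_mem (i : ℤ) ?_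
      simp only [Finset.mem_range] at hi
      rw [if_pos (by omega)]
      exact ⟨w, hw, rfl⟩
  · intro i hi N' h1 h2 hNW'
    by_cases h : 0 ≤ i ∧ i ≤ D
    · simp only [if_pos h] at hi
      apply hi
      rw [eq_bot_iff, Submodule.map_le_iff_le_comap, ← hNW']
      refine h2 _ fun k hk => ?_
      split_ifs with h'
      · rintro _ ⟨w, hw, rfl⟩
        simp only [Submodule.mem_comap, Submodule.mem_bot]
        rw [← tel_mul, hmul _ (by omega) _ (by omega) (by omega)]
        simp
      · exact bot_le
    · simp [if_neg h] at hi
  · intro i v hv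
    split_ifs at hv with h
    · obtain ⟨w, hw, rfl⟩ := hv
      rw [← tel_mul, hM _ (by omega)]
      simp
    · simp only [Submodule.mem_bot] at hv
      simp [hv]
  · intro i v hv
    split_ifs at hv with h
    · obtain ⟨w, hw, rfl⟩ := hv
      rw [hdec (Matrix.toEuclideanLin N _)]
      refine Submodule.sum_mem _ fun j hj => ?_
      simp only [Finset.mem_range] at hj
      have hmem : Matrix.toEuclideanLin (e j) (Matrix.toEuclideanLin N
          (Matrix.toEuclideanLin (e i.toNat) w)) ∈
          Submodule.map (Matrix.toEuclideanLin (e j)) W :=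
        ⟨_, hNW _ (heW _ (by omega) _ hw), rfl⟩
      by_cases hfar : j + 1 < i.toNat ∨ i.toNat + 1 < j
      · rw [← tel_mul, ← tel_mul, htri _ (by omega) _ (by omega) hfar]
        simp
      · have : (j : ℤ) = i - 1 ∨ (j : ℤ) = i ∨ (j : ℤ) = i + 1 := by omega
        rcases this with h' | h' | h'
        · apply Submodule.mem_sup_left
          apply Submodule.mem_sup_left
          rw [← h', if_pos (by omega)]
          exact hmem
        · apply Submodule.mem_sup_left
          apply Submodule.mem_sup_right
          have hij : i.toNat = j := by omega
          rw [if_pos h]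
          rw [hij] at hmem ⊢
          exact hmem
        · apply Submodule.mem_sup_right
          rw [← h', if_pos (by omega)]
          exact hmem
    · simp only [Submodule.mem_bot] at hv
      simp [hv]

namespace QPolyDRG

variable (S : QPolyDRG X) (x : X)

theorem adj_pow (k : ℕ) (y z : X) :
    (k < S.G.dist y z → (S.adj ^ k) y z = 0) ∧ (S.G.dist y z = k → (S.adj ^ k) y z ≠ 0) := by
  classical
  have : S.adj = S.G.adjMatrix ℂ := by
    ext y z
    simp [adj, Amat, SimpleGraph.adjMatrix_apply, SimpleGraph.dist_eq_one_iff_adj]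
  rw [this, SimpleGraph.adjMatrix_pow_apply_eq_card_walk]
  constructor
  · intro h
    rw [Nat.cast_eq_zero, Fintype.card_eq_zero_iff]
    exact ⟨fun p => by
      have h1 := SimpleGraph.dist_le p.1
      have h2 : p.1.length = k := p.2
      omega⟩
  · intro h
    rw [Nat.cast_ne_zero, ← Nat.pos_iff_ne_zero, Fintype.card_pos_iff]
    obtain ⟨p, hp⟩ := S.conn.exists_walk_length_eq_dist y z
    exact ⟨⟨p, by simp [hp, h]⟩⟩

theorem adj_pow_eq (k : ℕ) : S.adj ^ k = ∑ i ∈ Finset.range (S.D + 1), ((S.θ i : ℂ) ^ k) • S.E i := by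
  have h : ∀ i ≤ S.D, S.adj ^ k * S.E i = ((S.θ i : ℂ) ^ k) • S.E i := by
    intro i hi
    have h1 : S.adj * S.E i = (S.θ i : ℂ) • S.E i := S.hAE i hi
    induction k with
    | zero => simp
    | succ n ih => rw [pow_succ, mul_assoc, h1, mul_smul_comm, ih, smul_smul, pow_succ']
  conv_lhs => rw [← mul_one (S.adj ^ k), ← S.hEsum, Finset.mul_sum]
  refine Finset.sum_congr rfl fun i hi => h i ?_
  simp at hi; omega

theorem exists_dist (i : ℕ) (hi : i ≤ S.D) : ∃ y z, S.G.dist y z = i := by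
  obtain ⟨y, z, hyz⟩ := S.dist_eq
  obtain ⟨p, hp⟩ := S.conn.exists_walk_length_eq_dist y z
  refine ⟨y, p.getVert i, ?_⟩
  have h1 := SimpleGraph.dist_le (p.take i)
  have h2 := SimpleGraph.dist_le (p.drop i)
  have h3 := S.conn.dist_triangle (u := y) (v := p.getVert i) (w := z)
  rw [SimpleGraph.Walk.take_length] at h1
  rw [SimpleGraph.Walk.drop_length] at h2
  have : min i p.length ≤ i := min_le_left _ _
  omega

theorem E_const (i : ℕ) (hi : i ≤ S.D) : ∃ c : ℕ → ℂ, ∀ y z, S.E i y z = c (S.G.dist y z) := by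
  have := S.hEinM i hi
  generalize S.E i = M at this
  induction this using Submodule.span_induction with
  | mem B hB =>
    obtain ⟨k, _, rfl⟩ := hB
    exact ⟨fun n => if n = k then 1 else 0, fun y z => rfl⟩
  | zero => exact ⟨0, fun _ _ => rfl⟩
  | add B C _ _ hB hC =>
    obtain ⟨c, hc⟩ := hB
    obtain ⟨c', hc'⟩ := hC
    exact ⟨c + c', fun y z => by simp [hc, hc']⟩
  | smul r B _ hB =>
    obtain ⟨c, hc⟩ := hB
    exact ⟨r • c, fun y z => by simp [hc]⟩

theorem E_eq_of (y z y' z' : X) (h : S.E 1 y z = S.E 1 y' z') (k : ℕ) :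
    k ≤ S.D → S.E k y z = S.E k y' z' := by
  have hX : ((Fintype.card X : ℂ)) ≠ 0 := by
    have : Nonempty X := ⟨y⟩
    exact_mod_cast Fintype.card_ne_zero
  have hD := S.hD3
  induction k using Nat.strong_induction_on with
  | _ k ih =>
    intro hk
    rcases k with _ | k
    · simp [S.hE0]
    · have hK := S.hKrein 1 (by omega) k (by omega)
      have e1 := congrFun (congrFun hK y) z
      have e2 := congrFun (congrFun hK y') z'
      simp only [Matrix.hadamard_apply, Matrix.smul_apply, Matrix.sum_apply, smul_eq_mul] at e1 e2
      rw [h, ih k (by omega) (by omega), e2] at e1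
      have e3 := mul_left_cancel₀ (inv_ne_zero hX) e1
      have hmem : k + 1 ∈ Finset.range (S.D + 1) := by simp; omega
      rw [← Finset.add_sum_erase _ _ hmem, ← Finset.add_sum_erase _ _ hmem] at e3
      have e4 : ∑ h ∈ (Finset.range (S.D + 1)).erase (k + 1), (S.q h 1 k : ℂ) * S.E h y' z' =
          ∑ h ∈ (Finset.range (S.D + 1)).erase (k + 1), (S.q h 1 k : ℂ) * S.E h y z := by
        refine Finset.sum_congr rfl fun l hl => ?_
        simp only [Finset.mem_erase, Finset.mem_range] at hl
        rcases lt_or_gt_of_ne hl.1 with h' | h'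
        · rw [ih l h' (by omega)]
        · rw [S.hq_zero l (by omega) 1 (by omega) k (by omega) (by omega)]
          simp
      rw [e4] at e3
      have e5 := add_right_cancel e3
      refine (mul_left_cancel₀ ?_ e5).symm
      have := S.hq_ne (k + 1) (by omega) 1 (by omega) k (by omega) (by omega)
      exact_mod_cast this

theorem dual_inj (c : ℕ → ℂ) (hc : ∀ y z, S.E 1 y z = c (S.G.dist y z)) :
    ∀ i ≤ S.D, ∀ j ≤ S.D, c i = c j → i = j := by
  have key : ∀ i ≤ S.D, ∀ j ≤ S.D, i < j → c i ≠ c j := by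
    intro i hi j hj hij hcc
    obtain ⟨y, z, h1⟩ := S.exists_dist i hi
    obtain ⟨y', z', h2⟩ := S.exists_dist j hj
    have hE := S.E_eq_of y z y' z' (by rw [hc, hc, h1, h2, hcc])
    apply (S.adj_pow i y z).2 h1
    rw [← (S.adj_pow i y' z').1 (by omega), adj_pow_eq]
    simp only [Matrix.sum_apply, Matrix.smul_apply]
    refine Finset.sum_congr rfl fun k hk => ?_
    rw [hE k (by simp at hk; omega)]
  intro i hi j hj h
  rcases lt_trichotomy i j with h' | h' | h'
  · exact absurd h (key i hi j hj h')
  · exact h'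
  · exact absurd h.symm (key j hj i hi h')

theorem Estar_sum : ∑ i ∈ Finset.range (S.D + 1), S.Estar x i = 1 := by
  ext y z
  rw [Matrix.sum_apply]
  by_cases h : y = z
  · subst h
    simp only [Estar, Matrix.diagonal_apply_eq, Matrix.one_apply_eq]
    rw [Finset.sum_ite_eq, if_pos]
    have := S.dist_le x y
    simp; omega
  · simp [Estar, Matrix.diagonal_apply_ne _ h, Matrix.one_apply_ne h]

theorem Estar_mul (i j : ℕ) (hij : i ≠ j) : S.Estar x i * S.Estar x j = 0 := by
  rw [Estar, Estar, Matrix.diagonal_mul_diagonal]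
  ext y z
  by_cases h : y = z
  · subst h
    simp only [Matrix.diagonal_apply_eq, Matrix.zero_apply]
    split_ifs <;> simp
    omega
  · simp [Matrix.diagonal_apply_ne _ h]

theorem Estar_tri (i j : ℕ) (hij : i + 1 < j ∨ j + 1 < i) :
    S.Estar x i * S.adj * S.Estar x j = 0 := by
  ext y z
  rw [Estar, Estar, Matrix.mul_diagonal, Matrix.diagonal_mul]
  simp only [adj, Amat, Matrix.of_apply, Matrix.zero_apply]
  split_ifs with h1 h2 h3 <;> simp
  have a1 := S.conn.dist_triangle (u := x) (v := y) (w := z)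
  have a2 := S.conn.dist_triangle (u := x) (v := z) (w := y)
  rw [SimpleGraph.dist_comm (u := z) (v := y)] at a2
  omega

open scoped ComplexOrder in
theorem E_tri (i j : ℕ) (hi : i ≤ S.D) (hj : j ≤ S.D) (hij : i + 1 < j ∨ j + 1 < i) :
    S.E i * S.Astar x * S.E j = 0 := by
  have hD := S.hD3
  have hherm : ∀ k ≤ S.D, (S.E k)ᴴ = S.E k := by
    intro k hk
    rw [Matrix.conjTranspose, S.hEsym k hk]
    ext y z
    simp only [Matrix.map_apply]
    exact Complex.conj_eq_iff_im.2 (S.hEreal k hk y z)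
  have hAs : (S.Astar x)ᴴ = S.Astar x := by
    rw [Astar, Matrix.diagonal_conjTranspose]
    congr 1
    ext y
    have := Complex.conj_eq_iff_im.2 (S.hEreal 1 (by omega) x y)
    simp [this]
  have hidem : ∀ k ≤ S.D, S.E k * S.E k = S.E k := by
    intro k hk
    rw [S.hEmul k hk k hk, if_pos rfl]
  rw [← Matrix.trace_conjTranspose_mul_self_eq_zero_iff]
  rw [Matrix.conjTranspose_mul, Matrix.conjTranspose_mul, hherm i hi, hherm j hj, hAs]
  have e1 : S.E j * (S.Astar x * S.E i) * (S.E i * S.Astar x * S.E j) =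
      S.E j * (S.Astar x * S.E i * S.Astar x * S.E j) := by
    conv_rhs => rw [← hidem i hi]
    simp only [mul_assoc]
  rw [e1, Matrix.trace_mul_comm, mul_assoc, hidem j hj]
  have hsymm : ∀ k ≤ S.D, ∀ y z, S.E k y z = S.E k z y := fun k hk y z => by
    conv_lhs => rw [← S.hEsym k hk]
    rfl
  have e2 : Matrix.trace (S.Astar x * S.E i * S.Astar x * S.E j) =
      ∑ y, ∑ z, ((Fintype.card X : ℂ) * S.E 1 x y) * (Matrix.hadamard (S.E i) (S.E j) y z *
        ((Fintype.card X : ℂ) * S.E 1 x z)) := by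
    simp only [Matrix.trace, Matrix.diag_apply]
    refine Finset.sum_congr rfl fun y _ => ?_
    rw [Matrix.mul_apply]
    refine Finset.sum_congr rfl fun z _ => ?_
    rw [Astar, Matrix.mul_diagonal, Matrix.diagonal_mul, Matrix.hadamard_apply, hsymm j hj z y]
    ring
  rw [e2]
  refine Finset.sum_eq_zero fun y _ => ?_
  rw [← Finset.mul_sum]
  have e3 : ∑ z, Matrix.hadamard (S.E i) (S.E j) y z * ((Fintype.card X : ℂ) * S.E 1 x z) =
      (Fintype.card X : ℂ) * (Matrix.hadamard (S.E i) (S.E j) * S.E 1) y x := by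
    rw [Matrix.mul_apply, Finset.mul_sum]
    refine Finset.sum_congr rfl fun z _ => ?_
    rw [hsymm 1 (by omega) x z]
    ring
  have e4 : Matrix.hadamard (S.E i) (S.E j) * S.E 1 = 0 := by
    rw [S.hKrein i hi j hj, smul_mul_assoc, Finset.sum_mul, Finset.sum_eq_zero, smul_zero]
    intro k hk
    simp only [Finset.mem_range] at hk
    rw [smul_mul_assoc, S.hEmul k (by omega) 1 (by omega)]
    by_cases h : k = 1
    · subst h
      rw [S.hq_zero 1 (by omega) i hi j hj (by omega)]
      simp
    · simp [h]
  rw [e3, e4]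
  simp

end QPolyDRG

end helpers2
section helpers3

theorem set_eq_Icc (s : Set ℕ) (ρ D : ℕ) (hρ : IsLeast s ρ) (hD : ∀ i ∈ s, i ≤ D)
    (hc : ∀ i j k, i < j → j < k → i ∈ s → k ∈ s → j ∈ s) :
    ∃ d, s = Set.Icc ρ (ρ + d) ∧ s.ncard = d + 1 := by
  have hfin : s.Finite := (Set.finite_Iic D).subset hD
  obtain ⟨m, hm, hmax⟩ := Set.exists_max_image s id hfin ⟨ρ, hρ.1⟩
  have hρm : ρ ≤ m := hρ.2 hm
  have hs : s = Set.Icc ρ (ρ + (m - ρ)) := by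
    ext i
    constructor
    · intro hi
      have h1 := hρ.2 hi
      have h2 := hmax i hi
      simp only [id] at h2
      exact ⟨h1, by omega⟩
    · rintro ⟨h1, h2⟩
      rcases eq_or_lt_of_le h1 with rfl | h1
      · exact hρ.1
      · rcases eq_or_lt_of_le (show i ≤ m by omega) with rfl | h2
        · exact hm
        · exact hc ρ i m h1 h2 hρ.1 hm
  refine ⟨m - ρ, hs, ?_⟩
  rw [hs, ← Finset.coe_Icc, Set.ncard_coe_finset, Nat.card_Icc]
  omega

variable {X : Type*} [Fintype X] [DecidableEq X]

namespace QPolyDRG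

variable (S : QPolyDRG X) (x : X)

theorem irr_of {W : Submodule ℂ (EuclideanSpace ℂ X)} (hW : S.IsIrredTModule x W) :
    ∀ N ≤ W, (∀ v ∈ N, Matrix.toEuclideanLin S.adj v ∈ N) →
      (∀ v ∈ N, Matrix.toEuclideanLin (S.Astar x) v ∈ N) → N = ⊥ ∨ N = W := by
  intro N hN h1 h2
  refine hW.2.2 N hN ?_
  intro B hB
  unfold Talg at hB
  induction hB using Algebra.adjoin_induction with
  | mem M hM =>
    rcases hM with rfl | hM
    · exact h1
    · rw [Set.mem_singleton_iff] at hM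
      rw [hM]; exact h2
  | algebraMap r =>
    intro w hw
    rw [Algebra.algebraMap_eq_smul_one, map_smul, LinearMap.smul_apply, tel_one]
    exact Submodule.smul_mem _ _ hw
  | add M M' _ _ hM hM' =>
    intro w hw
    rw [map_add, LinearMap.add_apply]
    exact Submodule.add_mem _ (hM w hw) (hM' w hw)
  | mul M M' _ _ hM hM' =>
    intro w hw
    rw [tel_mul]
    exact hM _ (hM' w hw)

theorem half_star {W : Submodule ℂ (EuclideanSpace ℂ X)} (hW : S.IsTModule x W) :
    ∃ b, HalfTD W (Matrix.toEuclideanLin S.adj) (Matrix.toEuclideanLin (S.Astar x))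
      (S.EstarW x W) b := by
  have hD := S.hD3
  obtain ⟨c, hc⟩ := S.E_const 1 (by omega)
  have hX : ((Fintype.card X : ℂ)) ≠ 0 := by
    have : Nonempty X := ⟨x⟩
    exact_mod_cast Fintype.card_ne_zero
  have hM : ∀ i ≤ S.D, S.Astar x * S.Estar x i = ((Fintype.card X : ℂ) * c i) • S.Estar x i := by
    intro i _
    ext y z
    rw [Astar, Matrix.diagonal_mul, Matrix.smul_apply]
    by_cases h : y = z
    · subst h
      simp only [Estar, Matrix.diagonal_apply_eq]
      split_ifs with h'
      · rw [hc, h']; simp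
      · simp
    · simp [Estar, Matrix.diagonal_apply_ne _ h]
  refine ⟨_, halfTD_of S.D (S.Estar x) (S.Astar x) S.adj (fun i => (Fintype.card X : ℂ) * c i) W
    (S.Estar_sum x) hM (fun i _ j _ h => S.Estar_mul x i j h) ?_ ?_
    (fun i _ j _ h => S.Estar_tri x i j h)⟩
  · intro i hi w hw
    refine hW _ ?_ w hw
    refine Algebra.adjoin_mono ?_ (idem_mem_adjoin S.D (S.Estar x) (S.Astar x) _
      (S.Estar_sum x) hM ?_ i hi)
    · simp
    · intro i hi j hj hij
      exact S.dual_inj c hc i hi j hj (mul_left_cancel₀ hX hij)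
  · exact hW _ (Algebra.subset_adjoin (by simp))

theorem half_E {W : Submodule ℂ (EuclideanSpace ℂ X)} (hW : S.IsTModule x W) :
    ∃ a, HalfTD W (Matrix.toEuclideanLin (S.Astar x)) (Matrix.toEuclideanLin S.adj)
      (S.EW W) a := by
  have hM : ∀ i ≤ S.D, S.adj * S.E i = (S.θ i : ℂ) • S.E i := S.hAE
  refine ⟨_, halfTD_of S.D S.E S.adj (S.Astar x) (fun i => (S.θ i : ℂ)) W
    S.hEsum hM (fun i hi j hj h => by rw [S.hEmul i hi j hj, if_neg h]) ?_ ?_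
    (fun i hi j hj h => S.E_tri x i j hi hj h)⟩
  · intro i hi w hw
    refine hW _ ?_ w hw
    refine Algebra.adjoin_mono ?_ (idem_mem_adjoin S.D S.E S.adj _ S.hEsum hM ?_ i hi)
    · simp
    · intro i hi j hj hij
      exact S.θ_inj i hi j hj (by exact_mod_cast hij)
  · exact hW _ (Algebra.subset_adjoin (by simp))

end QPolyDRG

theorem supp_of {V : Type*} [AddCommGroup V] [Module ℂ V] {W : Submodule ℂ V}
    {A B : V →ₗ[ℂ] V} {P : ℤ → Submodule ℂ V} {b : ℤ → ℂ} (h : HalfTD W A B P b)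
    (irr : ∀ N ≤ W, (∀ v ∈ N, A v ∈ N) → (∀ v ∈ N, B v ∈ N) → N = ⊥ ∨ N = W)
    (D ρ : ℕ) (hP : ∀ i, P i ≠ ⊥ → 0 ≤ i ∧ i ≤ D)
    (hρ : IsLeast {i : ℕ | i ≤ D ∧ P i ≠ ⊥} ρ) :
    ∃ d : ℕ, (∀ i, P i ≠ ⊥ ↔ (ρ : ℤ) ≤ i ∧ i ≤ ρ + d) ∧
      Set.ncard {i : ℕ | i ≤ D ∧ P i ≠ ⊥} = d + 1 := by
  obtain ⟨d, hd, hcard⟩ := set_eq_Icc _ ρ D hρ (fun i hi => hi.1) (by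
    intro i j k hij hjk hi hk
    exact ⟨by have := hk.1; omega, h.convex irr (i := i) (k := k) (by omega) (by omega) hi.2 hk.2⟩)
  refine ⟨d, fun i => ?_, hcard⟩
  constructor
  · intro hi
    have h1 := hP i hi
    have h2 : i.toNat ∈ {i : ℕ | i ≤ D ∧ P i ≠ ⊥} :=
      ⟨by omega, by rwa [Int.toNat_of_nonneg h1.1]⟩
    rw [hd] at h2
    have h3 := h2.1
    have h4 := h2.2
    omega
  · intro hi
    have h2 : i.toNat ∈ Set.Icc ρ (ρ + d) := ⟨by omega, by omega⟩
    rw [← hd] at h2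
    have h3 := h2.2
    rwa [Int.toNat_of_nonneg (by omega)] at h3

theorem sup_Icc {V : Type*} [AddCommGroup V] [Module ℂ V] (P Q : ℤ → Submodule ℂ V)
    (l u : ℕ) (p : ℤ → Prop) (f g : ℤ → ℤ) (hPQ : ∀ k, Q (f k) = P k)
    (hg : ∀ k, Q k = P (g k))
    (h1 : ∀ k : ℕ, l ≤ k → k ≤ u → p (f k))
    (h2 : ∀ k : ℤ, p k → Q k ≠ ⊥ → (l : ℤ) ≤ g k ∧ g k ≤ u) :
    (⨆ k ∈ Finset.Icc l u, P (k : ℕ)) = ⨆ k, ⨆ (_ : p k), Q k := by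
  refine le_antisymm (iSup₂_le fun k hk => ?_) (iSup₂_le fun k hk => ?_)
  · rw [Finset.mem_Icc] at hk
    rw [← hPQ]
    exact le_iSup₂_of_le (f := fun k (_ : p k) => Q k) _ (h1 k hk.1 hk.2) le_rfl
  · by_cases hne : Q k = ⊥
    · rw [hne]; exact bot_le
    · have := h2 k hk hne
      rw [hg]
      refine le_iSup₂_of_le (f := fun k (_ : k ∈ Finset.Icc l u) => P (k : ℕ)) (g k).toNat
        (by rw [Finset.mem_Icc]; omega) ?_
      rw [Int.toNat_of_nonneg (by omega)]

end helpers3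


open QPolyDRG in
/-- The split decompositions of an irreducible `T`-module `W`: for each `μ, ν ∈ {↓,↑}`,
`W = W^{μν}_0 + W^{μν}_1 + ⋯ + W^{μν}_d` is a direct sum
(`μ = false` stands for `↓`, `μ = true` for `↑`, and similarly for `ν`). -/
theorem drg_tmodule_split {X : Type*} [Fintype X] [DecidableEq X] (S : QPolyDRG X) (x : X)
    (W : Submodule ℂ (EuclideanSpace ℂ X)) (hW : S.IsIrredTModule x W)
    (ρ τ d : ℕ)
    (hρ : IsLeast {i : ℕ | i ≤ S.D ∧ S.EstarW x W i ≠ ⊥} ρ)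
    (hτ : IsLeast {i : ℕ | i ≤ S.D ∧ S.EW W i ≠ ⊥} τ)
    (hd : d + 1 = Set.ncard {i : ℕ | i ≤ S.D ∧ S.EstarW x W i ≠ ⊥}) :
    ∀ μ ν : Bool,
      iSupIndep (fun h : Fin (d + 1) => S.Wsplit x W ρ τ d μ ν h) ∧
      (⨆ h : Fin (d + 1), S.Wsplit x W ρ τ d μ ν h) = W := by

  intro μ ν
  have irr := S.irr_of x hW
  obtain ⟨b, hP⟩ := S.half_star x hW.1
  obtain ⟨a, hQ⟩ := S.half_E x hW.1
  obtain ⟨d', hPs, hcard⟩ := supp_of hP irr S.D ρ (by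
    intro i hi
    by_contra h
    exact hi (by rw [EstarW, if_neg h])) hρ
  obtain ⟨δ, hQs, -⟩ := supp_of hQ (fun N h h1 h2 => irr N h h2 h1) S.D τ (by
    intro i hi
    by_contra h
    exact hi (by rw [EW, if_neg h])) hτ
  obtain rfl : d = d' := by omega
  obtain rfl : d = δ := (td_main (hP.shift ρ) (hQ.shift τ) irr d δ
    (fun i => (hPs _).trans (by omega)) (fun i => (hQs _).trans (by omega))).1
  -- the flags
  have main : ∀ P' Q' : ℤ → Submodule ℂ (EuclideanSpace ℂ X), ∀ a' b',
      HalfTD W (Matrix.toEuclideanLin S.adj) (Matrix.toEuclideanLin (S.Astar x)) P' b' →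
      HalfTD W (Matrix.toEuclideanLin (S.Astar x)) (Matrix.toEuclideanLin S.adj) Q' a' →
      (∀ i, P' i ≠ ⊥ ↔ 0 ≤ i ∧ i ≤ d) → (∀ i, Q' i ≠ ⊥ ↔ 0 ≤ i ∧ i ≤ d) →
      (∀ h : Fin (d + 1), (if μ then ⨆ k ∈ Finset.Icc (ρ + d - h) (ρ + d), S.EstarW x W k
        else ⨆ k ∈ Finset.Icc ρ (ρ + h), S.EstarW x W k) =
          ⨆ k, ⨆ (_ : k ≤ ((h : ℕ) : ℤ)), P' k) →
      (∀ h : Fin (d + 1), (if ν then ⨆ k ∈ Finset.Icc (τ + h) (τ + d), S.EW W k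
        else ⨆ k ∈ Finset.Icc τ (τ + d - h), S.EW W k) =
          ⨆ k, ⨆ (_ : ((h : ℕ) : ℤ) ≤ k), Q' k) →
      iSupIndep (fun h : Fin (d + 1) => S.Wsplit x W ρ τ d μ ν h) ∧
      (⨆ h : Fin (d + 1), S.Wsplit x W ρ τ d μ ν h) = W := by
    intro P' Q' a' b' h1 h2 h3 h4 h5 h6
    have := (td_main h1 h2 irr d d h3 h4).2
    simp only [← h5, ← h6] at this
    exact this
  obtain ⟨P', b', hP1, hP2, hP3⟩ : ∃ P' : ℤ → Submodule ℂ (EuclideanSpace ℂ X), ∃ b',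
      HalfTD W (Matrix.toEuclideanLin S.adj) (Matrix.toEuclideanLin (S.Astar x)) P' b' ∧
      (∀ i, P' i ≠ ⊥ ↔ 0 ≤ i ∧ i ≤ d) ∧
      (∀ h : Fin (d + 1), (if μ then ⨆ k ∈ Finset.Icc (ρ + d - h) (ρ + d), S.EstarW x W k
        else ⨆ k ∈ Finset.Icc ρ (ρ + h), S.EstarW x W k) =
          ⨆ k, ⨆ (_ : k ≤ ((h : ℕ) : ℤ)), P' k) := by
    cases μ
    · have hs : ∀ i, S.EstarW x W (ρ + i) ≠ ⊥ ↔ 0 ≤ i ∧ i ≤ d :=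
        fun i => (hPs _).trans (by omega)
      refine ⟨_, _, hP.shift ρ, hs, fun h => ?_⟩
      simp only [Bool.false_eq_true, if_false]
      refine sup_Icc (S.EstarW x W) (fun i => S.EstarW x W (ρ + i)) _ _ _ (fun k => k - ρ)
        (fun k => ρ + k) (fun k => by simp) (fun k => rfl) ?_ ?_
      · intro k h1 h2; omega
      · intro k h1 h2
        have := (hs k).1 h2
        push_cast; omega
    · have hs : ∀ i, S.EstarW x W ((ρ + d : ℤ) - i) ≠ ⊥ ↔ 0 ≤ i ∧ i ≤ d :=
        fun i => (hPs _).trans (by omega)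
      refine ⟨_, _, hP.refl (ρ + d : ℤ), hs, fun h => ?_⟩
      simp only [if_true]
      have hh := h.2
      refine sup_Icc (S.EstarW x W) (fun i => S.EstarW x W ((ρ + d : ℤ) - i)) _ _ _
        (fun k => (ρ + d : ℤ) - k)
        (fun k => (ρ + d : ℤ) - k) (fun k => by simp) (fun k => rfl) ?_ ?_
      · intro k h1 h2; omega
      · intro k h1 h2
        have := (hs k).1 h2
        omega
  obtain ⟨Q', a', hQ1, hQ2, hQ3⟩ : ∃ Q' : ℤ → Submodule ℂ (EuclideanSpace ℂ X), ∃ a',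
      HalfTD W (Matrix.toEuclideanLin (S.Astar x)) (Matrix.toEuclideanLin S.adj) Q' a' ∧
      (∀ i, Q' i ≠ ⊥ ↔ 0 ≤ i ∧ i ≤ d) ∧
      (∀ h : Fin (d + 1), (if ν then ⨆ k ∈ Finset.Icc (τ + h) (τ + d), S.EW W k
        else ⨆ k ∈ Finset.Icc τ (τ + d - h), S.EW W k) =
          ⨆ k, ⨆ (_ : ((h : ℕ) : ℤ) ≤ k), Q' k) := by
    cases ν
    · have hs : ∀ i, S.EW W ((τ + d : ℤ) - i) ≠ ⊥ ↔ 0 ≤ i ∧ i ≤ d :=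
        fun i => (hQs _).trans (by omega)
      refine ⟨_, _, hQ.refl (τ + d : ℤ), hs, fun h => ?_⟩
      simp only [Bool.false_eq_true, if_false]
      have hh := h.2
      refine sup_Icc (S.EW W) (fun i => S.EW W ((τ + d : ℤ) - i)) _ _ _
        (fun k => (τ + d : ℤ) - k)
        (fun k => (τ + d : ℤ) - k) (fun k => by simp) (fun k => rfl) ?_ ?_
      · intro k h1 h2; omega
      · intro k h1 h2
        have := (hs k).1 h2
        omega
    · have hs : ∀ i, S.EW W (τ + i) ≠ ⊥ ↔ 0 ≤ i ∧ i ≤ d :=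
        fun i => (hQs _).trans (by omega)
      refine ⟨_, _, hQ.shift τ, hs, fun h => ?_⟩
      simp only [if_true]
      refine sup_Icc (S.EW W) (fun i => S.EW W (τ + i)) _ _ _ (fun k => k - τ)
        (fun k => τ + k) (fun k => by simp) (fun k => rfl) ?_ ?_
      · intro k h1 h2; omega
      · intro k h1 h2
        have := (hs k).1 h2
        push_cast; omega
  exact main P' Q' a' b' hP1 hQ1 hP2 hQ2 hP3 hQ3

end
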